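/- For every linear map Λ on the space of 2^n × 2^n complex matrices, every Pauli word is an eigenvector of the Pauli twirl of Λ: for each g : Fin n → Fin 4 one has T(Λ)(P_g) = (2^{-n} · Tr(P_g · Λ(P_g))) • P_g. -/

import Mathlib

open Matrix

/-- The single-qubit Pauli matrices σ₀ = I, σ₁ = X, σ₂ = Y, σ₃ = Z. -/
noncomputable def pauli : Fin 4 → Matrix (Fin 2) (Fin 2) ℂ
  | 0 => !![1, 0; 0, 1]
  | 1 => !![0, 1; 1, 0]
  | 2 => !![0, -Complex.I; Complex.I, 0]
  | 3 => !![1, 0; 0, -1]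

/-- The n-qubit Pauli word `P_f = ⊗ᵢ σ_{f i}`, as a matrix indexed by `Fin n → Fin 2`. -/
noncomputable def pauliWord (n : ℕ) (f : Fin n → Fin 4) :
    Matrix (Fin n → Fin 2) (Fin n → Fin 2) ℂ :=
  Matrix.of fun x y => ∏ i, pauli (f i) (x i) (y i)

/-- The Pauli twirl of a linear map Λ on n-qubit matrices:
`T(Λ)(ρ) = 4^{-n} ∑_f P_f ⬝ Λ(P_f ⬝ ρ ⬝ P_f) ⬝ P_f`. -/
noncomputable def pauliTwirl {n : ℕ}
    (Λ : Matrix (Fin n → Fin 2) (Fin n → Fin 2) ℂ →ₗ[ℂ]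
         Matrix (Fin n → Fin 2) (Fin n → Fin 2) ℂ)
    (ρ : Matrix (Fin n → Fin 2) (Fin n → Fin 2) ℂ) :
    Matrix (Fin n → Fin 2) (Fin n → Fin 2) ℂ :=
  ((4 : ℂ) ^ n)⁻¹ • ∑ f : Fin n → Fin 4,
    pauliWord n f * Λ (pauliWord n f * ρ * pauliWord n f) * pauliWord n f

/-- The sign `s` with `σ_a σ_b σ_a = s σ_b`. -/
def pauliSign (a b : Fin 4) : ℂ :=
  if a = 0 ∨ b = 0 ∨ a = b then 1 else -1

theorem pauli_mul_mul_self (a b : Fin 4) :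
    pauli a * pauli b * pauli a = pauliSign a b • pauli b := by
  fin_cases a <;> fin_cases b <;> ext x y <;> fin_cases x <;> fin_cases y <;>
    simp [pauli, pauliSign, Matrix.mul_apply]

/-- The twisted completeness relation for the single-qubit Pauli matrices. -/
theorem sum_pauliSign_mul_pauli_mul_pauli (g : Fin 4) (x a b y : Fin 2) :
    ∑ f, pauliSign f g * (pauli f x a * pauli f b y) = 2 * (pauli g b a * pauli g x y) := by
  fin_cases g <;> fin_cases x <;> fin_cases a <;> fin_cases b <;> fin_cases y <;>
    simp [Fin.sum_univ_four, pauli, pauliSign] <;> norm_num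

theorem of_prod_mul_of_prod {ι κ R : Type*} [Fintype ι] [DecidableEq ι] [Fintype κ]
    [CommSemiring R] (M N : ι → Matrix κ κ R) :
    (of fun x y : ι → κ => ∏ i, M i (x i) (y i)) * (of fun x y => ∏ i, N i (x i) (y i)) =
      of fun x y => ∏ i, (M i * N i) (x i) (y i) := by
  ext x y
  simp only [mul_apply, of_apply, ← Finset.prod_mul_distrib, Fintype.prod_sum]

theorem pauliWord_mul_mul_self (n : ℕ) (f g : Fin n → Fin 4) :
    pauliWord n f * pauliWord n g * pauliWord n f =
      (∏ i, pauliSign (f i) (g i)) • pauliWord n g := by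
  simp only [pauliWord, of_prod_mul_of_prod (fun i => pauli (f i)) (fun i => pauli (g i)),
    of_prod_mul_of_prod (fun i => pauli (f i) * pauli (g i)) (fun i => pauli (f i)),
    pauli_mul_mul_self]
  ext x y
  simp [Finset.prod_mul_distrib]

/-- The twisted completeness relation for Pauli words. -/
theorem sum_prod_pauliSign_mul_pauliWord_mul_pauliWord (n : ℕ) (g : Fin n → Fin 4)
    (x a b y : Fin n → Fin 2) :
    ∑ f, (∏ i, pauliSign (f i) (g i)) * (pauliWord n f x a * pauliWord n f b y) =
      2 ^ n * (pauliWord n g b a * pauliWord n g x y) := by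
  simp only [pauliWord, of_apply, ← Finset.prod_mul_distrib]
  rw [← Fintype.prod_sum fun i c =>
    pauliSign c (g i) * (pauli c (x i) (a i) * pauli c (b i) (y i))]
  simp [sum_pauliSign_mul_pauli_mul_pauli, Finset.prod_mul_distrib]

theorem sum_prod_pauliSign_smul_pauliWord_mul_mul (n : ℕ) (g : Fin n → Fin 4)
    (A : Matrix (Fin n → Fin 2) (Fin n → Fin 2) ℂ) :
    ∑ f, (∏ i, pauliSign (f i) (g i)) • (pauliWord n f * A * pauliWord n f) =
      (2 ^ n * trace (pauliWord n g * A)) • pauliWord n g := by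
  ext x y
  calc (∑ f, (∏ i, pauliSign (f i) (g i)) • (pauliWord n f * A * pauliWord n f)) x y
      = ∑ f, ∑ b, ∑ a, A a b * ((∏ i, pauliSign (f i) (g i)) *
          (pauliWord n f x a * pauliWord n f b y)) := by
        simp only [Matrix.sum_apply, Matrix.smul_apply, mul_apply, Finset.sum_mul, smul_eq_mul,
          Finset.mul_sum]
        refine Finset.sum_congr rfl fun f _ => Finset.sum_congr rfl fun b _ =>
          Finset.sum_congr rfl fun a _ => by ring
    _ = ∑ b, ∑ a, A a b * (2 ^ n * (pauliWord n g b a * pauliWord n g x y)) := by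
        rw [Finset.sum_comm]
        refine Finset.sum_congr rfl fun b _ => ?_
        rw [Finset.sum_comm]
        simp only [← Finset.mul_sum, sum_prod_pauliSign_mul_pauliWord_mul_pauliWord]
    _ = ((2 ^ n * trace (pauliWord n g * A)) • pauliWord n g) x y := by
        simp only [trace, diag_apply, Matrix.smul_apply, mul_apply, Finset.sum_mul, smul_eq_mul,
          Finset.mul_sum]
        refine Finset.sum_congr rfl fun b _ => Finset.sum_congr rfl fun a _ => by ring

/-- Every Pauli word is an eigenvector of the Pauli twirl of any linear map Λ:
`T(Λ)(P_g) = (2^{-n} Tr(P_g ⬝ Λ(P_g))) • P_g`. -/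
theorem pauliTwirl_pauliWord_eq_smul (n : ℕ)
    (Λ : Matrix (Fin n → Fin 2) (Fin n → Fin 2) ℂ →ₗ[ℂ]
         Matrix (Fin n → Fin 2) (Fin n → Fin 2) ℂ)
    (g : Fin n → Fin 4) :
    pauliTwirl Λ (pauliWord n g) =
      (((2 : ℂ) ^ n)⁻¹ * Matrix.trace (pauliWord n g * Λ (pauliWord n g))) •
        pauliWord n g := by
  simp only [pauliTwirl, pauliWord_mul_mul_self, map_smul, mul_smul_comm, smul_mul_assoc]
  rw [sum_prod_pauliSign_smul_pauliWord_mul_mul, smul_smul, ← mul_assoc]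
  congr 2
  rw [show (4 : ℂ) = 2 * 2 by norm_num, mul_pow]
  field_simp
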